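/- Let κ : ℝ≥0 → ℝ be of class K¹ and continuously differentiable on (0, ∞) with κ'(r) > 0 for all r > 0, let ρ₁ > 0 and 0 < ρ₂ < 1, and let x⁰ ≠ 0. Define T(x⁰) = ρ₁·κ(|x⁰|)^{1−ρ₂} and x(t) = κ^{−1}((κ(|x⁰|)^{1−ρ₂} − t/ρ₁)^{1/(1−ρ₂)})·sign(x⁰) for 0 ≤ t ≤ T(x⁰), and x(t) = 0 for t > T(x⁰), where κ^{−1} is the inverse of κ as a bijection [0,∞) → [0,1). Then for every t ∈ (0, T(x⁰)), x is differentiable at t with derivative x'(t) = −(1/(ρ₁(1−ρ₂)))·(κ(|x(t)|)^{ρ₂}/κ'(|x(t)|))·sign(x(t)), i.e., x solves the predefined-time stable differential equation on (0, T(x⁰)). -/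

import Mathlib

/-- A function `κ : ℝ≥0 → ℝ` (modeled as `κ : ℝ → ℝ` with properties on `[0,∞)`)
is of class `K¹` if it is continuous, strictly increasing, `κ 0 = 0` and
`κ r → 1` as `r → ∞`. -/
def ClassK1 (κ : ℝ → ℝ) : Prop :=
  ContinuousOn κ (Set.Ici 0) ∧ StrictMonoOn κ (Set.Ici 0) ∧ κ 0 = 0 ∧
    Filter.Tendsto κ Filter.atTop (nhds 1)

theorem ClassK1.lt_one {κ : ℝ → ℝ} (hκ : ClassK1 κ) {r : ℝ} (hr : 0 ≤ r) : κ r < 1 := by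
  obtain ⟨-, hmono, -, hlim⟩ := hκ
  refine (hmono (Set.mem_Ici.2 hr) (Set.mem_Ici.2 (by linarith : (0 : ℝ) ≤ r + 1))
    (by linarith)).trans_le (ge_of_tendsto hlim ?_)
  filter_upwards [Filter.eventually_ge_atTop (r + 1)] with s hs
  exact hmono.monotoneOn (Set.mem_Ici.2 (by linarith)) (Set.mem_Ici.2 (by linarith)) hs

theorem ClassK1.pos {κ : ℝ → ℝ} (hκ : ClassK1 κ) {r : ℝ} (hr : 0 < r) : 0 < κ r := by
  have h := hκ.2.1 (Set.mem_Ici.2 le_rfl) (Set.mem_Ici.2 hr.le) hr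
  rwa [hκ.2.2.1] at h

theorem ClassK1.inverse_pos {κ κinv : ℝ → ℝ} (hκ : ClassK1 κ)
    (hinv_right : ∀ y : ℝ, 0 ≤ y → y < 1 → 0 ≤ κinv y ∧ κ (κinv y) = y)
    {y : ℝ} (hy0 : 0 < y) (hy1 : y < 1) : 0 < κinv y := by
  obtain ⟨h0, h1⟩ := hinv_right y hy0.le hy1
  refine h0.lt_of_ne fun h => ?_
  rw [← h, hκ.2.2.1] at h1
  exact hy0.ne h1

theorem ClassK1.continuousAt_inverse {κ κinv : ℝ → ℝ} (hκ : ClassK1 κ)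
    (hinv_left : ∀ r : ℝ, 0 ≤ r → κinv (κ r) = r)
    (hinv_right : ∀ y : ℝ, 0 ≤ y → y < 1 → 0 ≤ κinv y ∧ κ (κinv y) = y)
    {y : ℝ} (hy0 : 0 < y) (hy1 : y < 1) : ContinuousAt κinv y := by
  have hmono : StrictMonoOn κinv (Set.Ioo 0 1) := by
    intro u hu v hv huv
    obtain ⟨hu0, hu1⟩ := hinv_right u hu.1.le hu.2
    obtain ⟨hv0, hv1⟩ := hinv_right v hv.1.le hv.2
    rwa [← hκ.2.1.lt_iff_lt (Set.mem_Ici.2 hu0) (Set.mem_Ici.2 hv0), hu1, hv1]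
  refine hmono.continuousAt_of_image_mem_nhds (Ioo_mem_nhds hy0 hy1)
    (Filter.mem_of_superset (Ioi_mem_nhds (hκ.inverse_pos hinv_right hy0 hy1)) ?_)
  intro r hr
  exact ⟨κ r, ⟨hκ.pos hr, hκ.lt_one (le_of_lt hr)⟩, hinv_left r (le_of_lt hr)⟩

theorem ClassK1.hasDerivAt_inverse {κ κinv κ' : ℝ → ℝ} (hκ : ClassK1 κ)
    (hinv_left : ∀ r : ℝ, 0 ≤ r → κinv (κ r) = r)
    (hinv_right : ∀ y : ℝ, 0 ≤ y → y < 1 → 0 ≤ κinv y ∧ κ (κinv y) = y)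
    (hderiv : ∀ r : ℝ, 0 < r → HasDerivAt κ (κ' r) r)
    (hκ'pos : ∀ r : ℝ, 0 < r → 0 < κ' r)
    {y : ℝ} (hy0 : 0 < y) (hy1 : y < 1) : HasDerivAt κinv (κ' (κinv y))⁻¹ y := by
  have hpos := hκ.inverse_pos hinv_right hy0 hy1
  refine (hderiv _ hpos).of_local_left_inverse
    (hκ.continuousAt_inverse hinv_left hinv_right hy0 hy1) (hκ'pos _ hpos).ne' ?_
  filter_upwards [Ioo_mem_nhds hy0 hy1] with z hz
  exact (hinv_right z hz.1.le hz.2).2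

theorem Real.abs_mul_sign_of_pos {r a : ℝ} (hr : 0 < r) (ha : a ≠ 0) :
    |r * Real.sign a| = r := by
  rcases ha.lt_or_gt with h | h
  · simp [Real.sign_of_neg h, abs_of_pos hr]
  · simp [Real.sign_of_pos h, abs_of_pos hr]

theorem Real.sign_mul_sign_of_pos {r : ℝ} (hr : 0 < r) (a : ℝ) :
    Real.sign (r * Real.sign a) = Real.sign a := by
  rcases lt_trichotomy a 0 with h | rfl | h
  · simp [Real.sign_of_neg h, Real.sign_of_neg (neg_neg_of_pos hr)]
  · simp
  · simp [Real.sign_of_pos h, Real.sign_of_pos hr]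

/-- Let `κ` be of class `K¹`, continuously differentiable on `(0,∞)` with
derivative `κ' > 0` there, `ρ₁ > 0`, `0 < ρ₂ < 1`, and `x0 ≠ 0`.  Then the
function `x(t)` given by `κinv((κ(|x0|)^(1-ρ₂) - t/ρ₁)^(1/(1-ρ₂)))·sign(x0)`
for `0 ≤ t ≤ T(x0) = ρ₁·κ(|x0|)^(1-ρ₂)` and `0` afterwards solves
`x' = -(1/(ρ₁(1-ρ₂)))·(κ(|x|)^ρ₂/κ'(|x|))·sign(x)` on `(0, T(x0))`. -/
theorem solution_solves_ode (κ κinv κ' : ℝ → ℝ) (hκ : ClassK1 κ)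
    (hinv_left : ∀ r : ℝ, 0 ≤ r → κinv (κ r) = r)
    (hinv_right : ∀ y : ℝ, 0 ≤ y → y < 1 → 0 ≤ κinv y ∧ κ (κinv y) = y)
    (hderiv : ∀ r : ℝ, 0 < r → HasDerivAt κ (κ' r) r)
    (hκ'cont : ContinuousOn κ' (Set.Ioi 0))
    (hκ'pos : ∀ r : ℝ, 0 < r → 0 < κ' r)
    (ρ₁ ρ₂ : ℝ) (hρ₁ : 0 < ρ₁) (hρ₂0 : 0 < ρ₂) (hρ₂1 : ρ₂ < 1)
    (x0 : ℝ) (hx0 : x0 ≠ 0)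
    (T : ℝ) (hT : T = ρ₁ * (κ |x0|) ^ (1 - ρ₂))
    (x : ℝ → ℝ)
    (hx : ∀ t : ℝ, x t =
      if t ≤ T then
        κinv (((κ |x0|) ^ (1 - ρ₂) - t / ρ₁) ^ (1 / (1 - ρ₂))) * Real.sign x0
      else 0) :
    ∀ t ∈ Set.Ioo 0 T,
      HasDerivAt x
        (-(1 / (ρ₁ * (1 - ρ₂))) * ((κ |x t|) ^ ρ₂ / κ' |x t|) * Real.sign (x t))
        t := by
  rintro t ⟨ht0, htT⟩
  set a := κ |x0| ^ (1 - ρ₂) with ha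
  have hρ : 0 < 1 - ρ₂ := by linarith
  have hx0pos : 0 < |x0| := abs_pos.2 hx0
  have ha1 : a < 1 := Real.rpow_lt_one (hκ.pos hx0pos).le (hκ.lt_one hx0pos.le) hρ
  have htdiv : t / ρ₁ < a := by
    rw [div_lt_iff₀ hρ₁]
    linarith [mul_comm a ρ₁]
  have hb0 : 0 < a - t / ρ₁ := sub_pos.2 htdiv
  have hb1 : a - t / ρ₁ < 1 := by linarith [div_pos ht0 hρ₁]
  set b := a - t / ρ₁ with hb
  set y := b ^ (1 / (1 - ρ₂)) with hy
  have hy0 : 0 < y := Real.rpow_pos_of_pos hb0 _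
  have hy1 : y < 1 := Real.rpow_lt_one hb0.le hb1 (one_div_pos.2 hρ)
  have hinvpos := hκ.inverse_pos hinv_right hy0 hy1
  have hxt : x t = κinv y * Real.sign x0 := by rw [hx, if_pos htT.le]
  have hlin : HasDerivAt (fun s => a - s / ρ₁) (-(1 / ρ₁)) t :=
    ((hasDerivAt_id t).div_const ρ₁).const_sub a
  have hpow : HasDerivAt (fun s => (a - s / ρ₁) ^ (1 / (1 - ρ₂)))
      (-(1 / ρ₁) * (1 / (1 - ρ₂)) * b ^ (1 / (1 - ρ₂) - 1)) t :=
    hlin.rpow_const (Or.inl hb0.ne')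
  have hsol := ((hκ.hasDerivAt_inverse hinv_left hinv_right hderiv hκ'pos hy0 hy1).comp t
    hpow).mul_const (Real.sign x0)
  have hyρ : y ^ ρ₂ = b ^ (1 / (1 - ρ₂) - 1) := by
    rw [hy, ← Real.rpow_mul hb0.le]
    congr 1
    field_simp
    ring
  rw [hxt, Real.abs_mul_sign_of_pos hinvpos hx0, Real.sign_mul_sign_of_pos hinvpos,
    (hinv_right y hy0.le hy1).2, hyρ]
  refine (hsol.congr_of_eventuallyEq ?_).congr_deriv ?_
  · filter_upwards [Iio_mem_nhds htT] with s hs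
    rw [hx, if_pos (le_of_lt hs)]
    rfl
  · have := (hκ'pos _ hinvpos).ne'
    field_simp
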